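/- Let p > 0 and σ ≥ 0. For any A₁, A₂ ∈ GS_{p,σ}, the quasi-norm satisfies ‖A₁ + A₂‖_{GS_{p,σ}}^{p/(p+1)} ≤ ‖A₁‖_{GS_{p,σ}}^{p/(p+1)} + ‖A₂‖_{GS_{p,σ}}^{p/(p+1)}; in particular, ‖·‖_{GS_{p,σ}}^{p/(p+1)} defines a metric on GS_{p,σ}. -/

import Mathlib

open MeasureTheory Filter Complex
open scoped ENNReal InnerProductSpace RealInnerProductSpace

noncomputable section

def sVal {H : Type*} [NormedAddCommGroup H] [NormedSpace ℂ H]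
    (A : H →L[ℂ] H) (k : ℕ) : ℝ :=
  sInf ((fun F : H →L[ℂ] H => ‖A - F‖) ''
    {F | Module.rank ℂ (LinearMap.range (F : H →ₗ[ℂ] H)) ≤ (k : Cardinal)})

/-- `f_σ(t) = t / log^σ (t + e^{σ+1})` -/
def fSigma (σ t : ℝ) : ℝ := t / (Real.log (t + Real.exp (σ + 1))) ^ σ

variable {H : Type*} [NormedAddCommGroup H] [InnerProductSpace ℂ H]

/-- the weighted singular value sequence `s_k(A) f_σ(k)^{1/p}` (`k = 1, 2, ...`) -/
def sWeight (p σ : ℝ) (A : H →L[ℂ] H) (k : ℕ) : ℝ :=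
  sVal A k * fSigma σ (k + 1) ^ (1 / p)

/-- membership in the class `GS_{p,σ}`: compact with `s_k(A) = O(f_σ(k)^{-1/p})` -/
def MemGS (p σ : ℝ) (A : H →L[ℂ] H) : Prop :=
  IsCompactOperator ⇑A ∧ ∃ C : ℝ, ∀ k, sWeight p σ A k ≤ C

/-- the quasi-norm of `GS_{p,σ}` -/
def GSnorm (p σ : ℝ) (A : H →L[ℂ] H) : ℝ := ⨆ k : ℕ, sWeight p σ A k

/-- `G_{p,σ}(A) = limsup_k s_k(A) f_σ(k)^{1/p}` -/
def Gfun (p σ : ℝ) (A : H →L[ℂ] H) : ℝ := limsup (sWeight p σ A) atTop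

def gfun (p σ : ℝ) (A : H →L[ℂ] H) : ℝ := liminf (sWeight p σ A) atTop

def eigPlus (A : H →L[ℂ] H) (k : ℕ) : ℝ :=
  ⨅ V : {V : Submodule ℂ H // Module.rank ℂ V ≤ (k : Cardinal)},
    ⨆ u : {u : H // u ∈ (V : Submodule ℂ H)ᗮ ∧ ‖u‖ = 1},
      (⟪A u.1, u.1⟫_ℂ).re

def eigMinus (A : H →L[ℂ] H) (k : ℕ) : ℝ := eigPlus (-A) k

def GfunPlus (p σ : ℝ) (A : H →L[ℂ] H) : ℝ :=
  limsup (fun k => eigPlus A k * fSigma σ (k + 1) ^ (1 / p)) atTop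

def gfunPlus (p σ : ℝ) (A : H →L[ℂ] H) : ℝ :=
  liminf (fun k => eigPlus A k * fSigma σ (k + 1) ^ (1 / p)) atTop

def GfunMinus (p σ : ℝ) (A : H →L[ℂ] H) : ℝ := GfunPlus p σ (-A)

def gfunMinus (p σ : ℝ) (A : H →L[ℂ] H) : ℝ := gfunPlus p σ (-A)

/-- `N_{p,σ}[ρ]` (with the counting measure, this is `M_{p,σ}[v]`) -/
def Nfunc {α : Type*} [MeasurableSpace α] (p σ : ℝ) (μ : Measure α) (ρ : α → ℝ) : ℝ≥0∞ :=
  ⨆ (E : ℝ) (_ : 0 < E),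
    ENNReal.ofReal (E * (Real.log (E⁻¹ + 2)) ^ (-σ)) * (μ {τ | E < ρ τ}) ^ (1 / p)

/-- `N°_{p,σ}[ρ]` -/
def NfuncLim {α : Type*} [MeasurableSpace α] (p σ : ℝ) (μ : Measure α) (ρ : α → ℝ) : ℝ≥0∞ :=
  limsup (fun E : ℝ =>
    ENNReal.ofReal (E * (Real.log (E⁻¹ + 2)) ^ (-σ)) * (μ {τ | E < ρ τ}) ^ (1 / p))
    (nhdsWithin 0 (Set.Ioi 0))

theorem sVal_nonneg {E : Type*} [NormedAddCommGroup E] [NormedSpace ℂ E]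
    (A : E →L[ℂ] E) (k : ℕ) : 0 ≤ sVal A k := by
  apply Real.sInf_nonneg
  rintro _ ⟨F, -, rfl⟩
  exact norm_nonneg _

theorem sVal_add_le {E : Type*} [NormedAddCommGroup E] [NormedSpace ℂ E]
    (A B : E →L[ℂ] E) (m n : ℕ) : sVal (A + B) (m + n) ≤ sVal A m + sVal B n := by
  have nonempty (T : E →L[ℂ] E) (k : ℕ) : ((fun F : E →L[ℂ] E => ‖T - F‖) ''
      {F | Module.rank ℂ (LinearMap.range (F : E →ₗ[ℂ] E)) ≤ (k : Cardinal)}).Nonempty :=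
    Set.Nonempty.image _ ⟨0, by simp⟩
  refine le_of_forall_pos_le_add fun ε hε => ?_
  obtain ⟨_, ⟨F, hF, rfl⟩, hF'⟩ := exists_lt_of_csInf_lt (nonempty A m)
    (lt_add_of_pos_right (sVal A m) (half_pos hε))
  obtain ⟨_, ⟨G, hG, rfl⟩, hG'⟩ := exists_lt_of_csInf_lt (nonempty B n)
    (lt_add_of_pos_right (sVal B n) (half_pos hε))
  have hmem : sVal (A + B) (m + n) ≤ ‖A + B - (F + G)‖ := by
    refine csInf_le ⟨0, ?_⟩ ⟨F + G, ?_, rfl⟩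
    · rintro _ ⟨T, -, rfl⟩
      exact norm_nonneg _
    · have h := LinearMap.rank_add_le (F : E →ₗ[ℂ] E) (G : E →ₗ[ℂ] E)
      simp only [Set.mem_ofPred_eq, Nat.cast_add, ContinuousLinearMap.toLinearMap_add] at hF hG ⊢
      exact h.trans (add_le_add hF hG)
  have hnorm : ‖A + B - (F + G)‖ ≤ ‖A - F‖ + ‖B - G‖ := by
    rw [add_sub_add_comm]
    exact norm_add_le _ _
  simp only at hF' hG'
  linarith

theorem lt_log_add_exp {σ t : ℝ} (ht : 0 < t) : σ + 1 < Real.log (t + Real.exp (σ + 1)) := by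
  rw [Real.lt_log_iff_exp_lt (by positivity)]
  linarith

theorem fSigma_pos {σ t : ℝ} (hσ : 0 ≤ σ) (ht : 0 < t) : 0 < fSigma σ t := by
  have := lt_log_add_exp (σ := σ) ht
  exact div_pos ht (Real.rpow_pos_of_pos (by linarith) _)

theorem fSigma_le_fSigma {σ s t : ℝ} (hσ : 0 ≤ σ) (hs : 0 < s) (hst : s ≤ t) :
    fSigma σ s ≤ fSigma σ t := by
  have ht : 0 < t := hs.trans_le hst
  have hLs := lt_log_add_exp (σ := σ) hs
  have hLt := lt_log_add_exp (σ := σ) ht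
  have hE := Real.exp_pos (σ + 1)
  set E := Real.exp (σ + 1)
  have hu : 0 < s + E := by positivity
  have hv : 0 < t + E := by positivity
  have hdiff : Real.log (t + E) - Real.log (s + E) ≤ Real.log t - Real.log s := by
    rw [← Real.log_div hv.ne' hu.ne', ← Real.log_div ht.ne' hs.ne']
    refine Real.log_le_log (by positivity) ?_
    rw [div_le_div_iff₀ hu hs]
    nlinarith
  have hmono : Real.log (s + E) ≤ Real.log (t + E) := Real.log_le_log hu (by linarith)
  unfold fSigma
  set x := Real.log (s + E)
  set y := Real.log (t + E)
  have hx : 0 < x := by linarith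
  have hy : 0 < y := by linarith
  have hlog : σ * (Real.log y - Real.log x) ≤ Real.log t - Real.log s := by
    have h := Real.log_le_sub_one_of_pos (div_pos hy hx)
    rw [Real.log_div hy.ne' hx.ne', div_sub_one hx.ne'] at h
    have h2 : σ * ((y - x) / x) ≤ y - x := by
      rw [mul_div_assoc', div_le_iff₀ hx]
      nlinarith
    nlinarith
  have hxs := Real.rpow_pos_of_pos hx σ
  have hys := Real.rpow_pos_of_pos hy σ
  rw [← Real.log_le_log_iff (by positivity) (by positivity), Real.log_div hs.ne' hxs.ne',
    Real.log_div ht.ne' hys.ne', Real.log_rpow hx, Real.log_rpow hy]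
  linarith

theorem mul_fSigma_le {σ θ t : ℝ} (hσ : 0 ≤ σ) (hθ : 0 < θ) (hθ1 : θ ≤ 1) (ht : 0 < t) :
    θ * fSigma σ t ≤ fSigma σ (θ * t) := by
  have hs : 0 < θ * t := by positivity
  have hL := lt_log_add_exp (σ := σ) hs
  have hE := Real.exp_pos (σ + 1)
  unfold fSigma
  rw [mul_div_assoc']
  refine div_le_div_of_nonneg_left hs.le (Real.rpow_pos_of_pos (by linarith) _) ?_
  refine Real.rpow_le_rpow (by linarith) (Real.log_le_log (by positivity) ?_) hσ
  nlinarith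

/-- A bound `x * f_σ(r)^{1/p} ≤ a` at a point `r ≥ θ t` yields a bound with weight at `t`. -/
theorem mul_fSigma_rpow_le {p σ θ r t x a c : ℝ} (hp : 0 < p) (hσ : 0 ≤ σ) (hθ : 0 ≤ θ)
    (hθ1 : θ ≤ 1) (hr : 0 < r) (ht : 0 < t) (hrt : θ * t ≤ r) (hx : 0 ≤ x)
    (ha : x * fSigma σ r ^ (1 / p) ≤ a) (hac : a = c * θ * θ ^ (1 / p)) :
    x * fSigma σ t ^ (1 / p) ≤ c * θ := by
  rcases hθ.eq_or_lt with rfl | hθ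
  · have hpos : 0 < fSigma σ r ^ (1 / p) := Real.rpow_pos_of_pos (fSigma_pos hσ hr) _
    have hx0 : x = 0 := by
      refine le_antisymm (nonpos_of_mul_nonpos_left (a := x) ?_ hpos) hx
      simpa [hac] using ha
    simp [hx0]
  · have hf := (fSigma_pos hσ ht).le
    have hle : θ * fSigma σ t ≤ fSigma σ r :=
      (mul_fSigma_le hσ hθ hθ1 ht).trans (fSigma_le_fSigma hσ (by positivity) hrt)
    have hpow := Real.rpow_le_rpow (by positivity) hle (one_div_nonneg.mpr hp.le)
    rw [Real.mul_rpow hθ.le hf] at hpow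
    have hθp : 0 < θ ^ (1 / p) := Real.rpow_pos_of_pos hθ _
    refine le_of_mul_le_mul_right ?_ hθp
    calc x * fSigma σ t ^ (1 / p) * θ ^ (1 / p) = x * (θ ^ (1 / p) * fSigma σ t ^ (1 / p)) := by
          ring
      _ ≤ x * fSigma σ r ^ (1 / p) := mul_le_mul_of_nonneg_left hpow hx
      _ ≤ c * θ * θ ^ (1 / p) := ha.trans hac.le

theorem sWeight_nonneg {p σ : ℝ} (hσ : 0 ≤ σ) (A : H →L[ℂ] H) (k : ℕ) :
    0 ≤ sWeight p σ A k :=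
  mul_nonneg (sVal_nonneg A k) (Real.rpow_nonneg (fSigma_pos hσ (by positivity)).le _)

theorem GSnorm_nonneg {p σ : ℝ} (hσ : 0 ≤ σ) (A : H →L[ℂ] H) : 0 ≤ GSnorm p σ A :=
  Real.iSup_nonneg (sWeight_nonneg hσ A)

theorem MemGS.sWeight_le_GSnorm {p σ : ℝ} {A : H →L[ℂ] H} (h : MemGS p σ A) (k : ℕ) :
    sWeight p σ A k ≤ GSnorm p σ A := by
  obtain ⟨C, hC⟩ := h.2
  exact le_ciSup ⟨C, by rintro _ ⟨j, rfl⟩; exact hC j⟩ k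

/-- Splitting the index `k` in proportion `θ : 1 - θ` between the two summands. -/
theorem sWeight_add_le {p σ θ c : ℝ} (hp : 0 < p) (hσ : 0 ≤ σ) {A B : H →L[ℂ] H}
    (hA : MemGS p σ A) (hB : MemGS p σ B) (hθ : 0 < θ) (hθ1 : θ ≤ 1)
    (hAc : GSnorm p σ A = c * θ * θ ^ (1 / p))
    (hBc : GSnorm p σ B = c * (1 - θ) * (1 - θ) ^ (1 / p)) (k : ℕ) :
    sWeight p σ (A + B) k ≤ c := by
  have hk : (0 : ℝ) < k + 1 := by positivity
  obtain ⟨m, hm⟩ : ∃ m, ⌈θ * (k + 1)⌉₊ = m + 1 :=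
    Nat.exists_eq_succ_of_ne_zero (Nat.ceil_pos.mpr (by positivity)).ne'
  have hmle : θ * (k + 1) ≤ m + 1 := by
    have := Nat.le_ceil (θ * ((k : ℝ) + 1))
    rw [hm] at this
    exact_mod_cast this
  have hmlt : (m : ℝ) < θ * (k + 1) := by
    have := Nat.ceil_lt_add_one (a := θ * ((k : ℝ) + 1)) (by positivity)
    rw [hm] at this
    push_cast at this
    linarith
  have hmk : m ≤ k := by
    have : (m : ℝ) < k + 1 := by nlinarith
    exact Nat.lt_succ_iff.mp (by exact_mod_cast this)
  obtain ⟨n, rfl⟩ := Nat.exists_eq_add_of_le hmk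
  push_cast at hk hmle hmlt
  have h1 := mul_fSigma_rpow_le hp hσ hθ.le hθ1 (by positivity) hk hmle (sVal_nonneg A m)
    (hA.sWeight_le_GSnorm m) hAc
  have h2 := mul_fSigma_rpow_le (r := n + 1) hp hσ (sub_nonneg.mpr hθ1) (by linarith)
    (by positivity) hk (by linarith) (sVal_nonneg B n) (hB.sWeight_le_GSnorm n) hBc
  have h3 := mul_le_mul_of_nonneg_right (sVal_add_le A B m n)
    (Real.rpow_nonneg (fSigma_pos hσ hk).le (1 / p))
  unfold sWeight
  push_cast
  linarith

/-- **Proposition.** The quasi-norm of `GS_{p,σ}` satisfies the triangle-type inequality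
`‖A₁+A₂‖^{p/(p+1)} ≤ ‖A₁‖^{p/(p+1)} + ‖A₂‖^{p/(p+1)}`, so `‖·‖^{p/(p+1)}` defines a metric. -/
theorem GSnorm_triangle {H : Type*} [NormedAddCommGroup H] [InnerProductSpace ℂ H]
    [CompleteSpace H]
    (p σ : ℝ) (hp : 0 < p) (hσ : 0 ≤ σ)
    (A₁ A₂ : H →L[ℂ] H) (h₁ : MemGS p σ A₁) (h₂ : MemGS p σ A₂) :
    GSnorm p σ (A₁ + A₂) ^ (p / (p + 1)) ≤
      GSnorm p σ A₁ ^ (p / (p + 1)) + GSnorm p σ A₂ ^ (p / (p + 1)) := by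
  set a := GSnorm p σ A₁ with ha
  set b := GSnorm p σ A₂
  have ha0 : 0 ≤ a := GSnorm_nonneg hσ A₁
  have hb0 : 0 ≤ b := GSnorm_nonneg hσ A₂
  set q := p / (p + 1) with hq
  have hq0 : 0 < q := by positivity
  have hqp : 1 / q = 1 + 1 / p := by rw [hq]; field_simp
  rcases ha0.eq_or_lt with ha00 | hapos
  · have hle : GSnorm p σ (A₁ + A₂) ≤ b := by
      refine ciSup_le fun k => ?_
      have h0 := h₁.sWeight_le_GSnorm 0
      rw [← ha, ← ha00] at h0
      have hs0 : sVal A₁ 0 ≤ 0 := nonpos_of_mul_nonpos_left h0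
        (Real.rpow_pos_of_pos (fSigma_pos hσ (by positivity)) _)
      have hs := sVal_add_le A₁ A₂ 0 k
      rw [zero_add] at hs
      refine le_trans ?_ (h₂.sWeight_le_GSnorm k)
      exact mul_le_mul_of_nonneg_right (by linarith)
        (Real.rpow_nonneg (fSigma_pos hσ (by positivity)).le _)
    have := Real.rpow_le_rpow (GSnorm_nonneg hσ _) hle hq0.le
    have := Real.rpow_nonneg ha0 q
    linarith
  · have haq : 0 < a ^ q := Real.rpow_pos_of_pos hapos q
    have hbq : 0 ≤ b ^ q := Real.rpow_nonneg hb0 q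
    set S := a ^ q + b ^ q with hS
    have hSpos : 0 < S := by positivity
    have split {x : ℝ} (hx : 0 ≤ x) :
        x = S ^ (1 / q) * (x ^ q / S) * (x ^ q / S) ^ (1 / p) := by
      have hxS : 0 ≤ x ^ q / S := by positivity
      have : (x ^ q / S) * (x ^ q / S) ^ (1 / p) = (x ^ q / S) ^ (1 / q) := by
        rw [hqp, Real.rpow_add_of_nonneg hxS zero_le_one (by positivity), Real.rpow_one]
      rw [mul_assoc, this, ← Real.mul_rpow hSpos.le hxS, mul_div_cancel₀ _ hSpos.ne', one_div,
        Real.rpow_rpow_inv hx hq0.ne']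
    have hθ : 1 - a ^ q / S = b ^ q / S := by
      field_simp
      linarith
    have hle : GSnorm p σ (A₁ + A₂) ≤ S ^ (1 / q) :=
      ciSup_le <| sWeight_add_le hp hσ h₁ h₂ (θ := a ^ q / S) (by positivity)
        ((div_le_one hSpos).mpr (by linarith)) (split ha0) (by rw [hθ]; exact split hb0)
    calc GSnorm p σ (A₁ + A₂) ^ q ≤ (S ^ (1 / q)) ^ q :=
          Real.rpow_le_rpow (GSnorm_nonneg hσ _) hle hq0.le
      _ = S := by rw [one_div, Real.rpow_inv_rpow hSpos.le hq0.ne']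

end
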